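/- Let p be a prime and s, n positive integers with s ∣ n. Let u, d be positive integers such that u ≡ p^{j₀} (mod p^s − 1) for some 0 ≤ j₀ ≤ s−1, gcd(u, p^n − 1) = 1, and d·u ≡ 1 (mod p^n − 1). Let ∘ be a presemifield multiplication on L admitting a dual ⋆ that is right K-linear. Let η : L → L satisfy η(0) = 0 and, for every y ∈ L \ {0}, η(y) ≠ 0 and y ⋆ (η(y))⁻¹ = 1. Let α ∈ L with α ≠ 0 and i₀ ∈ K. Define μ : L → L by μ(0) = 0 and μ(y) = (η(y)⁻¹)^d for y ≠ 0, and define N : L × L → K by N(x,y) = Tr^n_s(α·x·μ(y)) + i₀·(1 − y^{p^n − 1}) (this value lies in K). Then N is a vectorial dual-bent function satisfying Condition A with ε = 1: there exists N* : L × L → K such that for every c ∈ K \ {0} and every (w,v) ∈ L × L, W_{N_c}(w,v) = p^n·ζ_p^{Tr^s_1(c·N*(w,v))}. -/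

import Mathlib

open Finset

/-- `ζ_p^t = exp(2πi·t.val/p)` for `t : ZMod p`. -/
noncomputable def zetaP (p : ℕ) (t : ZMod p) : ℂ :=
  Complex.exp (2 * Real.pi * Complex.I * (t.val : ℂ) / (p : ℂ))

noncomputable instance (p n : ℕ) [Fact p.Prime] : Fintype (GaloisField p n) :=
  Fintype.ofFinite _

/-- The absolute trace of `GaloisField p n` down to `ZMod p`. -/
noncomputable def absTr (p n : ℕ) [Fact p.Prime] (x : GaloisField p n) : ZMod p :=
  Algebra.trace (ZMod p) (GaloisField p n) x

/-- The relative trace to the `p^s`-element subfield of `GaloisField p n`,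
`x ↦ ∑_{j=0}^{n/s−1} x^{(p^s)^j}`, as an element of `GaloisField p n`. -/
noncomputable def relTr (p n s : ℕ) [Fact p.Prime] (x : GaloisField p n) : GaloisField p n :=
  ∑ j ∈ Finset.range (n / s), x ^ (p ^ s) ^ j

theorem zetaP_eq_stdAddChar (p : ℕ) [Fact p.Prime] (t : ZMod p) :
    zetaP p t = ZMod.stdAddChar t := by
  rw [ZMod.stdAddChar_apply, ZMod.toCircle_apply, zetaP]

theorem zetaP_zero (p : ℕ) [Fact p.Prime] : zetaP p 0 = 1 := by
  rw [zetaP_eq_stdAddChar, AddChar.map_zero_eq_one]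

theorem zetaP_add (p : ℕ) [Fact p.Prime] (a b : ZMod p) :
    zetaP p (a + b) = zetaP p a * zetaP p b := by
  simp only [zetaP_eq_stdAddChar, AddChar.map_add_eq_mul]

section Trace

variable {p : ℕ} [Fact p.Prime] {n s : ℕ}

theorem absTr_zero : absTr p n 0 = 0 := map_zero _

theorem absTr_add (x y : GaloisField p n) : absTr p n (x + y) = absTr p n x + absTr p n y :=
  map_add _ x y

theorem absTr_neg (x : GaloisField p n) : absTr p n (-x) = -absTr p n x :=
  map_neg _ x

theorem absTr_sub (x y : GaloisField p n) : absTr p n (x - y) = absTr p n x - absTr p n y :=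
  map_sub _ x y

theorem eq_zero_of_absTr_mul_eq_zero {a : GaloisField p n}
    (h : ∀ b, absTr p n (b * a) = 0) : a = 0 := by
  refine (traceForm_nondegenerate (ZMod p) (GaloisField p n)).1 a fun b => ?_
  rw [Algebra.traceForm_apply, mul_comm]
  exact h b

theorem eq_of_absTr_mul_eq {a a' : GaloisField p n}
    (h : ∀ b, absTr p n (b * a) = absTr p n (b * a')) : a = a' := by
  refine sub_eq_zero.mp (eq_zero_of_absTr_mul_eq_zero fun b => ?_)
  rw [mul_sub, absTr_sub, h, sub_self]

theorem absTr_pow_pow (x : GaloisField p n) (j : ℕ) : absTr p n (x ^ p ^ j) = absTr p n x := by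
  induction j with
  | zero => simp
  | succ j ih =>
    rw [← ih, pow_succ, pow_mul]
    have h := Algebra.trace_eq_of_algEquiv
      (FiniteField.frobeniusAlgEquivOfAlgebraic (ZMod p) (GaloisField p n)) (x ^ p ^ j)
    simpa [absTr, ZMod.card] using h

theorem sum_zetaP_absTr_mul (hn : 0 < n) (a : GaloisField p n) [Decidable (a = 0)] :
    ∑ x, zetaP p (absTr p n (x * a)) = if a = 0 then (p : ℂ) ^ n else 0 := by
  split_ifs with ha
  · subst ha
    have hc : Fintype.card (GaloisField p n) = p ^ n := by
      rw [Fintype.card_eq_nat_card, GaloisField.card p n hn.ne']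
    simp [absTr_zero, zetaP_zero, hc]
  · let ψ : AddChar (GaloisField p n) ℂ :=
      { toFun := fun x => zetaP p (absTr p n (x * a))
        map_zero_eq_one' := by simp [absTr_zero, zetaP_zero]
        map_add_eq_mul' := fun x y => by rw [add_mul, absTr_add, zetaP_add] }
    have hψ : ψ ≠ 1 := by
      intro h
      refine ha (eq_zero_of_absTr_mul_eq_zero fun b => ?_)
      have hb : zetaP p (absTr p n (b * a)) = zetaP p 0 := by
        rw [zetaP_zero]
        exact DFunLike.congr_fun h b
      rw [zetaP_eq_stdAddChar, zetaP_eq_stdAddChar] at hb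
      exact ZMod.injective_stdAddChar hb
    exact AddChar.sum_eq_zero_of_ne_one hψ

/-- The relative trace takes values in the image of the subfield, and the absolute trace is
transitive through it. -/
theorem exists_relTr_lift (hn : 0 < n) (hs : 0 < s) (ι : GaloisField p s →+* GaloisField p n) :
    ∃ T : GaloisField p n → GaloisField p s, (∀ z, ι (T z) = relTr p n s z) ∧
      ∀ c z, absTr p s (c * T z) = absTr p n (ι c * z) := by
  let : Algebra (GaloisField p s) (GaloisField p n) := ι.toAlgebra
  have : IsScalarTower (ZMod p) (GaloisField p s) (GaloisField p n) :=
    IsScalarTower.of_algebraMap_eq' (Subsingleton.elim _ _)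
  have hfin : Module.finrank (GaloisField p s) (GaloisField p n) = n / s := by
    have h := Module.finrank_mul_finrank (ZMod p) (GaloisField p s) (GaloisField p n)
    rw [GaloisField.finrank p hs.ne', GaloisField.finrank p hn.ne'] at h
    exact (Nat.div_eq_of_eq_mul_right hs h.symm).symm
  refine ⟨Algebra.trace (GaloisField p s) (GaloisField p n), fun z => ?_, fun c z => ?_⟩
  · have h := FiniteField.algebraMap_trace_eq_sum_pow (GaloisField p s) (GaloisField p n) z
    rw [hfin, GaloisField.card p s hs.ne'] at h
    exact h
  · have h := LinearMap.map_smul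
      (Algebra.trace (GaloisField p s) (GaloisField p n)) c z
    rw [smul_eq_mul] at h
    rw [absTr, absTr, ← h, Algebra.trace_trace, Algebra.smul_def]
    rfl

end Trace

section Power

variable {p : ℕ} [Fact p.Prime] {n : ℕ}

theorem GaloisField.pow_eq_pow_of_modEq (hn : 0 < n) {x : GaloisField p n} (hx : x ≠ 0)
    {a b : ℕ} (h : a ≡ b [MOD p ^ n - 1]) : x ^ a = x ^ b := by
  have h1 : x ^ (p ^ n - 1) = 1 := by
    rw [← GaloisField.card p n hn.ne', ← Fintype.card_eq_nat_card]
    exact FiniteField.pow_card_sub_one_eq_one x hx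
  exact _root_.pow_eq_pow_of_modEq h h1

theorem GaloisField.surjective_pow_pow (j : ℕ) :
    Function.Surjective fun x : GaloisField p n => x ^ p ^ j :=
  Finite.surjective_of_injective (iterateFrobenius_inj (GaloisField p n) p j)

end Power

section Presemifield

variable {p : ℕ} [Fact p.Prime] {n : ℕ}
  {mul str : GaloisField p n → GaloisField p n → GaloisField p n}

theorem presemifield_mul_right_surjective
    (haddl : ∀ x y z, mul (x + y) z = mul x z + mul y z)
    (hzero : ∀ x y, mul x y = 0 → x = 0 ∨ y = 0) {t : GaloisField p n} (ht : t ≠ 0) :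
    Function.Surjective fun x => mul x t := by
  let f : GaloisField p n →+ GaloisField p n := AddMonoidHom.mk' (mul · t) fun x y => haddl x y t
  refine Finite.surjective_of_injective ((injective_iff_map_eq_zero f).2 fun x hx => ?_)
  exact (hzero x t hx).resolve_right ht

theorem dual_add_left
    (hdual : ∀ x y z, absTr p n (z * mul x y) = absTr p n (x * str z y))
    (a b t : GaloisField p n) : str (a + b) t = str a t + str b t :=
  eq_of_absTr_mul_eq fun x => by
    rw [mul_add, absTr_add, ← hdual, ← hdual, ← hdual, add_mul, absTr_add]

theorem dual_add_right
    (haddr : ∀ x y z, mul z (x + y) = mul z x + mul z y)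
    (hdual : ∀ x y z, absTr p n (z * mul x y) = absTr p n (x * str z y))
    (z a b : GaloisField p n) : str z (a + b) = str z a + str z b :=
  eq_of_absTr_mul_eq fun x => by
    rw [mul_add, absTr_add, ← hdual, ← hdual, ← hdual, haddr, mul_add, absTr_add]

theorem dual_eq_zero
    (haddl : ∀ x y z, mul (x + y) z = mul x z + mul y z)
    (hzero : ∀ x y, mul x y = 0 → x = 0 ∨ y = 0)
    (hdual : ∀ x y z, absTr p n (z * mul x y) = absTr p n (x * str z y))
    {y t : GaloisField p n} (h : str y t = 0) : y = 0 ∨ t = 0 := by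
  refine or_iff_not_imp_right.2 fun ht => eq_zero_of_absTr_mul_eq_zero fun b => ?_
  obtain ⟨x, rfl⟩ := presemifield_mul_right_surjective haddl hzero ht b
  rw [mul_comm, hdual, h, mul_zero, absTr_zero]

/-- For nonzero `t`, the equation `η(y)⁻¹ = t` has exactly one nonzero solution, which satisfies
`y ⋆ t = 1`. -/
theorem exists_dual_eq_one
    (haddl : ∀ x y z, mul (x + y) z = mul x z + mul y z)
    (haddr : ∀ x y z, mul z (x + y) = mul z x + mul z y)
    (hzero : ∀ x y, mul x y = 0 → x = 0 ∨ y = 0)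
    (hdual : ∀ x y z, absTr p n (z * mul x y) = absTr p n (x * str z y))
    {η : GaloisField p n → GaloisField p n}
    (hη : ∀ y, y ≠ 0 → η y ≠ 0 ∧ str y (η y)⁻¹ = 1)
    {t : GaloisField p n} (ht : t ≠ 0) :
    ∃ y₀, str y₀ t = 1 ∧ ∀ y, y ≠ 0 ∧ (η y)⁻¹ = t ↔ y = y₀ := by
  let f : GaloisField p n →+ GaloisField p n :=
    AddMonoidHom.mk' (str · t) fun x y => dual_add_left hdual x y t
  have hf : Function.Injective f := (injective_iff_map_eq_zero f).2 fun x hx =>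
    (dual_eq_zero haddl hzero hdual hx).resolve_right ht
  obtain ⟨y₀, h₀⟩ := Finite.surjective_of_injective hf 1
  have hy₀ : y₀ ≠ 0 := by
    rintro rfl
    rw [map_zero] at h₀
    exact zero_ne_one h₀
  refine ⟨y₀, h₀, fun y => ⟨?_, ?_⟩⟩
  · rintro ⟨hy, rfl⟩
    exact hf ((hη y hy).2.trans h₀.symm)
  · rintro rfl
    let g : GaloisField p n →+ GaloisField p n :=
      AddMonoidHom.mk' (str y) fun a b => dual_add_right haddr hdual y a b
    have hg : Function.Injective g := (injective_iff_map_eq_zero g).2 fun a ha =>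
      (dual_eq_zero haddl hzero hdual ha).resolve_left hy₀
    exact ⟨hy₀, hg ((hη y hy₀).2.trans h₀.symm)⟩

end Presemifield

theorem stmt7 (p : ℕ) [Fact p.Prime] (n s : ℕ) (hn : 0 < n) (hs : 0 < s) (hsn : s ∣ n)
    (u d : ℕ) (hu : 0 < u) (hd : 0 < d)
    (j₀ : ℕ) (hj₀ : j₀ < s) (hmod : u ≡ p ^ j₀ [MOD p ^ s - 1])
    (hgcd : Nat.gcd u (p ^ n - 1) = 1) (hdu : d * u ≡ 1 [MOD p ^ n - 1])
    -- a presemifield multiplication `∘` on `L = GaloisField p n`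
    (mul : GaloisField p n → GaloisField p n → GaloisField p n)
    (hmul_addl : ∀ x y z, mul (x + y) z = mul x z + mul y z)
    (hmul_addr : ∀ x y z, mul z (x + y) = mul z x + mul z y)
    (hmul_zero : ∀ x y, mul x y = 0 → x = 0 ∨ y = 0)
    -- a dual `⋆` of `∘`
    (str : GaloisField p n → GaloisField p n → GaloisField p n)
    (hdual : ∀ x y z, absTr p n (z * mul x y) = absTr p n (x * str z y))
    -- the subfield `K` with `p^s` elements, realized via a ring embedding
    (ι : GaloisField p s →+* GaloisField p n)
    -- `⋆` is right `K`-linear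
    (hlin : ∀ (x y : GaloisField p n) (c : GaloisField p s),
      str x (ι c * y) = ι c * str x y)
    -- `η(0) = 0` and, for `y ≠ 0`, `η(y) ≠ 0` with `y ⋆ η(y)⁻¹ = 1`
    (η : GaloisField p n → GaloisField p n)
    (hη0 : η 0 = 0)
    (hη : ∀ y, y ≠ 0 → η y ≠ 0 ∧ str y (η y)⁻¹ = 1)
    (α : GaloisField p n) (hα : α ≠ 0) (i₀ : GaloisField p s)
    -- `μ(0) = 0` and `μ(y) = (η(y)⁻¹)^d` for `y ≠ 0`
    (μ : GaloisField p n → GaloisField p n)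
    (hμ0 : μ 0 = 0)
    (hμ : ∀ y, y ≠ 0 → μ y = ((η y)⁻¹) ^ d)
    -- `N(x,y) = Tr^n_s(α·x·μ(y)) + i₀·(1 − y^{p^n−1})`, a `K`-valued function
    (N : GaloisField p n → GaloisField p n → GaloisField p s)
    (hN : ∀ x y, ι (N x y) = relTr p n s (α * x * μ y) + ι i₀ * (1 - y ^ (p ^ n - 1))) :
    -- `N` is vectorial dual-bent satisfying Condition A with `ε = 1`
    ∃ Nd : GaloisField p n → GaloisField p n → GaloisField p s,
      ∀ c : GaloisField p s, c ≠ 0 → ∀ w v : GaloisField p n,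
        (∑ x : GaloisField p n, ∑ y : GaloisField p n,
            zetaP p (absTr p s (c * N x y) - absTr p n (w * x + v * y))) =
          (p : ℂ) ^ n * zetaP p (absTr p s (c * Nd w v)) := by
  classical
  obtain ⟨T, hT, hTtr⟩ := exists_relTr_lift hn hs ι
  have hpn : p ^ n - 1 ≠ 0 := by
    have := Nat.one_lt_pow hn.ne' (Fact.out : p.Prime).one_lt
    omega
  have hN' : ∀ x y, N x y = T (α * x * μ y) + if y = 0 then i₀ else 0 := by
    intro x y
    apply ι.injective
    rw [hN, map_add, hT]
    split_ifs with hy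
    · simp [hy, hpn]
    · have h := GaloisField.pow_eq_pow_of_modEq hn hy
        (show p ^ n - 1 ≡ 0 [MOD p ^ n - 1] by simp [Nat.ModEq])
      rw [h]
      simp
  have hμ_ne : ∀ y, y ≠ 0 → μ y ≠ 0 := fun y hy => by
    rw [hμ y hy]
    exact pow_ne_zero _ (inv_ne_zero (hη y hy).1)
  have hsum : ∀ (c : GaloisField p s) (w v : GaloisField p n),
      (∑ x : GaloisField p n, ∑ y : GaloisField p n,
        zetaP p (absTr p s (c * N x y) - absTr p n (w * x + v * y))) =
      ∑ y : GaloisField p n, if ι c * α * μ y - w = 0 then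
        (p : ℂ) ^ n * zetaP p (absTr p s (c * if y = 0 then i₀ else 0) - absTr p n (v * y))
        else 0 := by
    intro c w v
    rw [Finset.sum_comm]
    refine Finset.sum_congr rfl fun y _ => ?_
    rw [← ite_zero_mul, ← sum_zetaP_absTr_mul hn, Finset.sum_mul]
    refine Finset.sum_congr rfl fun x _ => ?_
    rw [← zetaP_add, hN', mul_add, absTr_add, hTtr, absTr_add]
    congr 1
    have e : ι c * (α * x * μ y) = x * (ι c * α * μ y - w) + w * x := by ring
    rw [e, absTr_add]
    ring
  have hdual_arg : ∀ w v : GaloisField p n, ∃ x', w ≠ 0 →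
      mul (x' ^ p ^ j₀) ((w * α⁻¹) ^ u) = v := by
    intro w v
    by_cases hw : w = 0
    · exact ⟨0, fun h => absurd hw h⟩
    · obtain ⟨x, hx⟩ := presemifield_mul_right_surjective hmul_addl hmul_zero
        (pow_ne_zero u (mul_ne_zero hw (inv_ne_zero hα))) v
      obtain ⟨x', rfl⟩ := GaloisField.surjective_pow_pow j₀ x
      exact ⟨x', fun _ => hx⟩
  choose X hX using hdual_arg
  refine ⟨fun w v => if w = 0 then i₀ else -T (X w v), fun c hc w v => ?_⟩
  have hιc : ι c ≠ 0 := (map_ne_zero ι).2 hc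
  rw [hsum]
  beta_reduce
  by_cases hw : w = 0
  · subst hw
    rw [Finset.sum_eq_single 0]
    · simp [hμ0, absTr_zero]
    · intro y _ hy
      rw [if_neg]
      rw [sub_zero]
      exact mul_ne_zero (mul_ne_zero hιc hα) (hμ_ne y hy)
    · simp
  · have hcu : ι c ^ u = ι (c ^ p ^ j₀) := by
      rw [← map_pow, GaloisField.pow_eq_pow_of_modEq hs hc hmod]
    set z : GaloisField p n := (w * α⁻¹) ^ u with hz
    set r : GaloisField p n := w * α⁻¹ * (ι c)⁻¹ with hr
    have hr0 : r ≠ 0 := mul_ne_zero (mul_ne_zero hw (inv_ne_zero hα)) (inv_ne_zero hιc)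
    obtain ⟨y₀, hy₀, huniq⟩ := exists_dual_eq_one hmul_addl hmul_addr hmul_zero hdual hη
      (pow_ne_zero u hr0)
    have hsupp : ∀ y, ι c * α * μ y - w = 0 ↔ y = y₀ := by
      intro y
      have e : ι c * α * μ y - w = 0 ↔ μ y = r := by
        rw [hr, sub_eq_zero]
        constructor
        · rintro rfl
          field_simp
        · intro h
          rw [h]
          field_simp
      rw [e, ← huniq]
      constructor
      · intro h
        have hy : y ≠ 0 := by
          rintro rfl
          exact hr0 (h.symm.trans hμ0)
        refine ⟨hy, ?_⟩
        rw [← h, hμ y hy, ← pow_mul,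
          GaloisField.pow_eq_pow_of_modEq hn (inv_ne_zero (hη y hy).1) hdu, pow_one]
      · rintro ⟨hy, h⟩
        rw [hμ y hy, h, ← pow_mul, mul_comm u d,
          GaloisField.pow_eq_pow_of_modEq hn hr0 hdu, pow_one]
    have hy₀0 : y₀ ≠ 0 := ((huniq y₀).2 rfl).1
    have hstr : str y₀ z = ι (c ^ p ^ j₀) := by
      have e : z = ι (c ^ p ^ j₀) * r ^ u := by
        rw [← hcu, hz, hr, ← mul_pow]
        congr 1
        field_simp
      rw [e, hlin, hy₀, mul_one]
    have htr : absTr p n (v * y₀) = absTr p s (c * T (X w v)) := by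
      have h := hdual (X w v ^ p ^ j₀) z y₀
      rw [hX w v hw, hstr, map_pow, ← mul_pow, absTr_pow_pow] at h
      rw [mul_comm, h, hTtr, mul_comm]
    rw [Finset.sum_eq_single y₀]
    · rw [if_pos ((hsupp y₀).2 rfl), if_neg hy₀0, if_neg hw, mul_zero, absTr_zero, zero_sub,
        htr, mul_neg, absTr_neg]
    · intro y _ hy
      rw [if_neg (mt (hsupp y).1 hy)]
    · simp
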